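/- Let (B_p)_{p∈ℕ} be a family of ℚ-vector spaces, let σ_p : B_{p−1} → B_p be linear maps for p ≥ 1 (and set σ_0 to be the zero map into B_0, so im σ_0 = 0), and let τ_{q,p} : B_p → B_q be linear maps for all 0 ≤ q ≤ p satisfying: (i) τ_{p,p} = id for all p; (ii) τ_{q,p} ∘ σ_p = τ_{q,p−1} + σ_q ∘ τ_{q−1,p−1} for all 1 ≤ q ≤ p−1, and τ_{0,p} ∘ σ_p = τ_{0,p−1} for all p ≥ 1; (iii) τ_{q,p−1} ∘ τ_{p−1,p} = (p−q)·τ_{q,p} for all 0 ≤ q ≤ p−1. Suppose moreover that for every p the map B_p → ⨁_{q=0}^{p} B_q/im(σ_q) whose q-th component is the composite of τ_{q,p} with the projection B_q → B_q/im(σ_q) is an isomorphism. Then for every p ≥ 1 the composite τ_{p−1,p} ∘ σ_p : B_{p−1} → B_{p−1} is an isomorphism; in particular, if σ_p is an isomorphism then τ_{p−1,p} is an isomorphism. -/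

import Mathlib

noncomputable section

/-- The image of the stabilization maps: `im σ_0 = 0` and `im σ_q = range (σ (q-1))` for
`q ≥ 1` (here `σ p : B p →ₗ[ℚ] B (p+1)` denotes the map written `σ_{p+1}` in the paper). -/
def imSigma {B : ℕ → Type} [∀ p, AddCommGroup (B p)] [∀ p, Module ℚ (B p)]
    (σ : ∀ p : ℕ, B p →ₗ[ℚ] B (p + 1)) : ∀ q : ℕ, Submodule ℚ (B q)
  | 0 => ⊥
  | q + 1 => LinearMap.range (σ q)

/-- Dold's lemma on transfer maps: given stabilization maps `σ` and transfer maps `τ`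
satisfying the stated identities, and such that the total transfer map
`B p → ⨁_{q ≤ p} B q / im σ_q` is an isomorphism for every `p`, the composite
`τ_{p-1,p} ∘ σ_p : B_{p-1} → B_{p-1}` is an isomorphism for all `p ≥ 1`; in particular, if
`σ_p` is an isomorphism then so is `τ_{p-1,p}`.  (Indices are shifted: `σ p = σ_{p+1}` and
`τ q p = τ_{q,p}`.) -/
theorem transfer_inverse_to_stabilization
    (B : ℕ → Type) [∀ p, AddCommGroup (B p)] [∀ p, Module ℚ (B p)]
    (σ : ∀ p : ℕ, B p →ₗ[ℚ] B (p + 1))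
    (τ : ∀ q p : ℕ, B p →ₗ[ℚ] B q)
    (h_id : ∀ p : ℕ, τ p p = LinearMap.id)
    (h_rec : ∀ p q : ℕ, q + 1 ≤ p →
      (τ (q + 1) (p + 1)).comp (σ p) = τ (q + 1) p + (σ q).comp (τ q p))
    (h_rec0 : ∀ p : ℕ, (τ 0 (p + 1)).comp (σ p) = τ 0 p)
    (h_comp : ∀ p q : ℕ, q ≤ p →
      (τ q p).comp (τ p (p + 1)) = ((p : ℚ) + 1 - (q : ℚ)) • τ q (p + 1))
    (h_decomp : ∀ p : ℕ, Function.Bijective fun x : B p =>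
      (fun q : Fin (p + 1) => Submodule.Quotient.mk (p := imSigma σ q) (τ q p x))) :
    ∀ p : ℕ, Function.Bijective ((τ p (p + 1)).comp (σ p)) ∧
      (Function.Bijective (σ p) → Function.Bijective (τ p (p + 1))) := by
  have key : ∀ p q : ℕ, q ≤ p → ∀ x : B p,
      Submodule.Quotient.mk (p := imSigma σ q) (τ q p (τ p (p + 1) (σ p x))) =
        ((p : ℚ) + 1 - (q : ℚ)) • Submodule.Quotient.mk (p := imSigma σ q) (τ q p x) := by
    intro p q hq x
    have h1 := LinearMap.congr_fun (h_comp p q hq) (σ p x)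
    simp only [LinearMap.comp_apply, LinearMap.smul_apply] at h1
    rw [h1, Submodule.Quotient.mk_smul]
    congr 1
    cases q with
    | zero =>
      have h2 := LinearMap.congr_fun (h_rec0 p) x
      simp only [LinearMap.comp_apply] at h2
      rw [h2]
    | succ q =>
      have h2 := LinearMap.congr_fun (h_rec p q hq) x
      simp only [LinearMap.comp_apply, LinearMap.add_apply] at h2
      rw [h2, Submodule.Quotient.eq, add_sub_cancel_left]
      exact LinearMap.mem_range_self (σ q) _
  have hne : ∀ p q : ℕ, q ≤ p → ((p : ℚ) + 1 - (q : ℚ)) ≠ 0 := by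
    intro p q hq
    have : (q : ℚ) ≤ p := by exact_mod_cast hq
    linarith
  intro p
  have hb : Function.Bijective ((τ p (p + 1)).comp (σ p)) := by
    constructor
    · intro x y hxy
      apply (h_decomp p).1
      funext q
      have hq : (q : ℕ) ≤ p := Nat.lt_succ_iff.mp q.2
      have hx := key p q hq x
      have hy := key p q hq y
      simp only [LinearMap.comp_apply] at hxy
      rw [hxy, hy] at hx
      exact (smul_right_injective _ (hne p q hq) hx).symm
    · intro y
      obtain ⟨x, hx⟩ := (h_decomp p).2 (fun q : Fin (p + 1) =>
        ((p : ℚ) + 1 - ((q : ℕ) : ℚ))⁻¹ •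
          Submodule.Quotient.mk (p := imSigma σ q) (τ q p y))
      refine ⟨x, (h_decomp p).1 ?_⟩
      funext q
      have hq : (q : ℕ) ≤ p := Nat.lt_succ_iff.mp q.2
      have hxq := congrFun hx q
      simp only [LinearMap.comp_apply] at hxq ⊢
      rw [key p q hq x, hxq, smul_inv_smul₀ (hne p q hq)]
  refine ⟨hb, fun hs => ?_⟩
  rw [LinearMap.coe_comp] at hb
  exact (Function.Bijective.of_comp_iff _ hs).mp hb

end
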